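/- arXiv:1903.11142 — 6 statements merged into one kernel-verified Lean document; each statement's English description precedes it below -/
import Mathlib

section
/- Let λ, λ′ > 0 and let p, p′ : ℕ → ℝ be probability mass functions with p(0) = p′(0) = 0. Let q = exp(λ(p − δ₀)), q′ = exp(λ′(p′ − δ₀)) and r = exp(−λ(p − δ₀)). If ‖q′ − q‖₁ < 1/‖r‖₁, then |λ′ − λ| + ‖λ′p′ − λp‖₁ ≤ ‖r‖₁‖q′ − q‖₁ / (1 − ‖r‖₁‖q′ − q‖₁); in particular ‖λ′p′ − λp‖₁ ≤ ‖r‖₁‖q′ − q‖₁ / (1 − ‖r‖₁‖q′ − q‖₁). -/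
open MeasureTheory
open scoped BigOperators Classical

noncomputable section

/-- Discrete convolution of two sequences. -/
def conv (a b : ℕ → ℝ) : ℕ → ℝ := fun i => ∑ k ∈ Finset.range (i + 1), a k * b (i - k)

/-- The sequence δ₀ with δ₀(0) = 1 and δ₀(k) = 0 for k ≥ 1. -/
def delta0 : ℕ → ℝ := fun i => if i = 0 then 1 else 0

/-- Convolution powers: a^{∗0} = δ₀, a^{∗(n+1)} = a^{∗n} ∗ a. -/
def convPow (a : ℕ → ℝ) : ℕ → ℕ → ℝ
  | 0 => delta0
  | n + 1 => conv (convPow a n) a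

/-- The ℓ¹ norm of a sequence. -/
def l1 (a : ℕ → ℝ) : ℝ := ∑' i, |a i|

/-- exp(a) = ∑_{j=0}^∞ a^{∗j}/j!, defined coordinatewise. -/
def expSeq (a : ℕ → ℝ) : ℕ → ℝ := fun i => ∑' j, convPow a j i / (Nat.factorial j : ℝ)

/-- p is a probability mass function on ℕ₀. -/
def IsPMF (p : ℕ → ℝ) : Prop := (∀ i, 0 ≤ p i) ∧ ∑' i, p i = 1

/-- Kullback–Leibler divergence. -/
def KL (u v : ℕ → ℝ) : ℝ := ∑' i, u i * Real.log (u i / v i)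

/-- The V divergence. -/
def Vd (u v : ℕ → ℝ) : ℝ := ∑' i, u i * (Real.log (u i / v i)) ^ 2

/-- Squared Hellinger distance. -/
def hellSq (u v : ℕ → ℝ) : ℝ := ∑' i, (Real.sqrt (u i) - Real.sqrt (v i)) ^ 2

/-- Hellinger distance. -/
def hell (u v : ℕ → ℝ) : ℝ := Real.sqrt (hellSq u v)

/-- The compound Poisson distribution of (λ, p). -/
def cpq (lam : ℝ) (p : ℕ → ℝ) : ℕ → ℝ :=
  fun i => ∑' n, Real.exp (-lam) * lam ^ n / (Nat.factorial n : ℝ) * convPow p n i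

/-- The evaluation at `x` of the power series with coefficients `a`. -/
def genFun (a : ℕ → ℝ) (x : ℝ) : ℝ := ∑' i, a i * x ^ i

/-- The power series `∑ c j * a^{∗j}` in the convolution algebra, coordinatewise. -/
def convSeries (c a : ℕ → ℝ) : ℕ → ℝ := fun i => ∑' j, c j * convPow a j i

lemma l1_nonneg (a : ℕ → ℝ) : 0 ≤ l1 a := tsum_nonneg fun i => abs_nonneg (a i)

lemma abs_tsum_le {a : ℕ → ℝ} (ha : Summable fun i => |a i|) : |∑' i, a i| ≤ ∑' i, |a i| := by
  simp only [← Real.norm_eq_abs] at ha ⊢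
  exact norm_tsum_le_tsum_norm ha

lemma abs_mul_pow_le {x : ℝ} (hx : |x| ≤ 1) (t : ℝ) (i : ℕ) : |t * x ^ i| ≤ |t| := by
  rw [abs_mul, abs_pow]
  exact mul_le_of_le_one_right (abs_nonneg _) (pow_le_one₀ (abs_nonneg _) hx)

lemma summable_abs_mul_pow {a : ℕ → ℝ} (ha : Summable fun i => |a i|) {x : ℝ} (hx : |x| ≤ 1) :
    Summable fun i => |a i * x ^ i| :=
  ha.of_nonneg_of_le (fun _ => abs_nonneg _) fun i => abs_mul_pow_le hx (a i) i

lemma abs_genFun_le {a : ℕ → ℝ} (ha : Summable fun i => |a i|) {x : ℝ} (hx : |x| ≤ 1) :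
    |genFun a x| ≤ l1 a :=
  (abs_tsum_le (summable_abs_mul_pow ha hx)).trans
    ((summable_abs_mul_pow ha hx).tsum_le_tsum (fun i => abs_mul_pow_le hx (a i) i) ha)

lemma genFun_sub {a b : ℕ → ℝ} (ha : Summable fun i => |a i|) (hb : Summable fun i => |b i|)
    {x : ℝ} (hx : |x| ≤ 1) : genFun (fun i => a i - b i) x = genFun a x - genFun b x := by
  simp only [genFun, sub_mul]
  exact (summable_abs_mul_pow ha hx).of_abs.tsum_sub (summable_abs_mul_pow hb hx).of_abs

lemma genFun_neg (a : ℕ → ℝ) (x : ℝ) : genFun (fun i => -a i) x = -genFun a x := by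
  simp only [genFun, neg_mul, tsum_neg]

/-- A sequence is determined by its power series on `[-1, 1]`. -/
lemma eq_of_genFun_eq {a b : ℕ → ℝ} (ha : Summable fun i => |a i|)
    (hb : Summable fun i => |b i|) (h : ∀ x : ℝ, |x| ≤ 1 → genFun a x = genFun b x) : a = b := by
  have key : ∀ {c : ℕ → ℝ}, (Summable fun i => |c i|) →
      HasFPowerSeriesAt (genFun c) (FormalMultilinearSeries.ofScalars ℝ c) 0 := by
    intro c hc
    rw [hasFPowerSeriesAt_iff]
    filter_upwards [Metric.ball_mem_nhds (0 : ℝ) one_pos] with x hx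
    have hx' : |x| ≤ 1 := by simpa using (mem_ball_zero_iff.1 hx).le
    simpa [FormalMultilinearSeries.coeff_ofScalars, mul_comm, genFun] using
      (summable_abs_mul_pow hc hx').of_abs.hasSum
  have hab : genFun a =ᶠ[nhds 0] genFun b := by
    filter_upwards [Metric.ball_mem_nhds (0 : ℝ) one_pos] with x hx
    exact h x (by simpa using (mem_ball_zero_iff.1 hx).le)
  have hs := (key ha).eq_formalMultilinearSeries_of_eventually (key hb) hab
  funext n
  simpa [FormalMultilinearSeries.coeff_ofScalars] using congrArg (fun s => s.coeff n) hs

lemma abs_conv_le (a b : ℕ → ℝ) (i : ℕ) :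
    |conv a b i| ≤ conv (fun k => |a k|) (fun k => |b k|) i :=
  (Finset.abs_sum_le_sum_abs _ _).trans_eq (by simp [conv, abs_mul])

lemma summable_conv {a b : ℕ → ℝ} (ha : Summable fun i => |a i|) (hb : Summable fun i => |b i|) :
    Summable fun i => |conv a b i| := by
  simp only [← Real.norm_eq_abs] at ha hb ⊢
  exact summable_norm_sum_mul_range_of_summable_norm ha hb

lemma l1_conv_le {a b : ℕ → ℝ} (ha : Summable fun i => |a i|) (hb : Summable fun i => |b i|) :
    l1 (conv a b) ≤ l1 a * l1 b := by
  have ha' : Summable fun i => ‖|a i|‖ := by simpa using ha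
  have hb' : Summable fun i => ‖|b i|‖ := by simpa using hb
  rw [l1, l1, l1, tsum_mul_tsum_eq_tsum_sum_range_of_summable_norm ha' hb']
  exact (summable_conv ha hb).tsum_le_tsum (abs_conv_le a b)
    (summable_norm_sum_mul_range_of_summable_norm ha' hb').of_norm

lemma genFun_conv {a b : ℕ → ℝ} (ha : Summable fun i => |a i|) (hb : Summable fun i => |b i|)
    {x : ℝ} (hx : |x| ≤ 1) : genFun (conv a b) x = genFun a x * genFun b x := by
  have ha' := summable_abs_mul_pow ha hx
  have hb' := summable_abs_mul_pow hb hx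
  simp only [← Real.norm_eq_abs] at ha' hb'
  rw [genFun, genFun, genFun, tsum_mul_tsum_eq_tsum_sum_range_of_summable_norm ha' hb']
  refine tsum_congr fun i => ?_
  rw [conv, Finset.sum_mul]
  refine Finset.sum_congr rfl fun k hk => ?_
  have hki : k + (i - k) = i := by grind
  calc a k * b (i - k) * x ^ i = a k * b (i - k) * x ^ (k + (i - k)) := by rw [hki]
    _ = a k * x ^ k * (b (i - k) * x ^ (i - k)) := by ring

lemma summable_abs_delta0 : Summable fun i => |delta0 i| :=
  summable_of_ne_finset_zero (s := {0}) fun i hi => by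
    simp [delta0, Finset.mem_singleton.not.1 hi]

lemma l1_delta0 : l1 delta0 = 1 := by
  rw [l1, tsum_eq_single 0 fun i hi => by simp [delta0, hi]]
  simp [delta0]

lemma genFun_delta0 (x : ℝ) : genFun delta0 x = 1 := by
  rw [genFun, tsum_eq_single 0 fun i hi => by simp [delta0, hi]]
  simp [delta0]

lemma summable_convPow {a : ℕ → ℝ} (ha : Summable fun i => |a i|) (n : ℕ) :
    Summable fun i => |convPow a n i| := by
  induction n with
  | zero => exact summable_abs_delta0
  | succ n ih => exact summable_conv ih ha

lemma l1_convPow_le {a : ℕ → ℝ} (ha : Summable fun i => |a i|) (n : ℕ) :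
    l1 (convPow a n) ≤ l1 a ^ n := by
  induction n with
  | zero => exact (l1_delta0.trans (pow_zero _).symm).le
  | succ n ih =>
    rw [pow_succ]
    exact (l1_conv_le (summable_convPow ha n) ha).trans
      (mul_le_mul_of_nonneg_right ih (l1_nonneg a))

lemma genFun_convPow {a : ℕ → ℝ} (ha : Summable fun i => |a i|) {x : ℝ} (hx : |x| ≤ 1) (n : ℕ) :
    genFun (convPow a n) x = genFun a x ^ n := by
  induction n with
  | zero => exact (genFun_delta0 x).trans (pow_zero _).symm
  | succ n ih => rw [convPow, genFun_conv (summable_convPow ha n) ha hx, ih, pow_succ]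

section ConvSeries

variable {a c : ℕ → ℝ}

lemma tsum_abs_mul_convPow_le (ha : Summable fun i => |a i|) (j : ℕ) :
    ∑' i, |c j * convPow a j i| ≤ |c j| * l1 a ^ j := by
  simp only [abs_mul, tsum_mul_left]
  exact mul_le_mul_of_nonneg_left (l1_convPow_le ha j) (abs_nonneg _)

lemma summable_tsum_abs_mul_convPow (ha : Summable fun i => |a i|)
    (hc : Summable fun j => |c j| * l1 a ^ j) :
    Summable fun j => ∑' i, |c j * convPow a j i| :=
  hc.of_nonneg_of_le (fun _ => tsum_nonneg fun _ => abs_nonneg _) (tsum_abs_mul_convPow_le ha)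

lemma summable_abs_mul_convPow (ha : Summable fun i => |a i|)
    (hc : Summable fun j => |c j| * l1 a ^ j) :
    Summable fun z : ℕ × ℕ => |c z.1 * convPow a z.1 z.2| := by
  refine (summable_prod_of_nonneg fun _ => abs_nonneg _).2
    ⟨fun j => ?_, summable_tsum_abs_mul_convPow ha hc⟩
  simpa only [abs_mul] using (summable_convPow ha j).mul_left |c j|

lemma abs_convSeries_le (ha : Summable fun i => |a i|)
    (hc : Summable fun j => |c j| * l1 a ^ j) (i : ℕ) :
    |convSeries c a i| ≤ ∑' j, |c j * convPow a j i| :=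
  abs_tsum_le ((summable_abs_mul_convPow ha hc).prod_symm.prod_factor i)

lemma summable_convSeries (ha : Summable fun i => |a i|)
    (hc : Summable fun j => |c j| * l1 a ^ j) : Summable fun i => |convSeries c a i| :=
  (summable_abs_mul_convPow ha hc).prod_symm.prod.of_nonneg_of_le (fun _ => abs_nonneg _)
    (abs_convSeries_le ha hc)

lemma l1_convSeries_le (ha : Summable fun i => |a i|)
    (hc : Summable fun j => |c j| * l1 a ^ j) :
    l1 (convSeries c a) ≤ ∑' j, |c j| * l1 a ^ j :=
  calc l1 (convSeries c a) ≤ ∑' i, ∑' j, |c j * convPow a j i| :=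
        (summable_convSeries ha hc).tsum_le_tsum (abs_convSeries_le ha hc)
          (summable_abs_mul_convPow ha hc).prod_symm.prod
    _ = ∑' j, ∑' i, |c j * convPow a j i| :=
        Summable.tsum_comm (f := fun j i => |c j * convPow a j i|) (summable_abs_mul_convPow ha hc)
    _ ≤ ∑' j, |c j| * l1 a ^ j :=
        (summable_tsum_abs_mul_convPow ha hc).tsum_le_tsum (tsum_abs_mul_convPow_le ha) hc

lemma genFun_convSeries (ha : Summable fun i => |a i|)
    (hc : Summable fun j => |c j| * l1 a ^ j) {x : ℝ} (hx : |x| ≤ 1) :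
    genFun (convSeries c a) x = ∑' j, c j * genFun a x ^ j := by
  have hs : Summable fun z : ℕ × ℕ => c z.1 * convPow a z.1 z.2 * x ^ z.2 := by
    refine Summable.of_abs ?_
    refine Summable.of_nonneg_of_le (fun z => abs_nonneg _) (fun z => ?_)
      (summable_abs_mul_convPow ha hc)
    exact abs_mul_pow_le hx (c z.1 * convPow a z.1 z.2) z.2
  calc genFun (convSeries c a) x = ∑' i, ∑' j, c j * convPow a j i * x ^ i := by
        simp only [genFun, convSeries, tsum_mul_right]
    _ = ∑' j, ∑' i, c j * convPow a j i * x ^ i :=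
        Summable.tsum_comm (f := fun j i => c j * convPow a j i * x ^ i) hs
    _ = ∑' j, c j * genFun a x ^ j := by
        refine tsum_congr fun j => ?_
        rw [← genFun_convPow ha hx, genFun, ← tsum_mul_left]
        simp only [mul_assoc]

end ConvSeries

lemma expSeq_eq_convSeries (a : ℕ → ℝ) :
    expSeq a = convSeries (fun j => ((Nat.factorial j : ℝ))⁻¹) a := by
  funext i
  exact tsum_congr fun j => div_eq_inv_mul _ _

lemma summable_inv_factorial_mul_pow (t : ℝ) :
    Summable fun j => |((Nat.factorial j : ℝ))⁻¹| * t ^ j := by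
  refine (Real.summable_pow_div_factorial t).congr fun j => ?_
  rw [abs_of_nonneg (by positivity), div_eq_inv_mul]

lemma summable_expSeq {a : ℕ → ℝ} (ha : Summable fun i => |a i|) :
    Summable fun i => |expSeq a i| := by
  rw [expSeq_eq_convSeries]
  exact summable_convSeries ha (summable_inv_factorial_mul_pow _)

lemma genFun_expSeq {a : ℕ → ℝ} (ha : Summable fun i => |a i|) {x : ℝ} (hx : |x| ≤ 1) :
    genFun (expSeq a) x = Real.exp (genFun a x) := by
  rw [expSeq_eq_convSeries, genFun_convSeries ha (summable_inv_factorial_mul_pow _) hx,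
    Real.exp_eq_exp_ℝ, NormedSpace.exp_eq_tsum_div]
  exact tsum_congr fun j => (div_eq_inv_mul _ _).symm

lemma hasSum_inv_mul_pow {t : ℝ} (ht : |t| < 1) :
    HasSum (fun j : ℕ => (j : ℝ)⁻¹ * t ^ j) (-Real.log (1 - t)) := by
  rw [← hasSum_nat_add_iff' 1]
  simpa [div_eq_inv_mul] using Real.hasSum_pow_div_log_of_abs_lt_one ht

/-- If `exp b = (1 - u) exp a` in the convolution algebra with `‖u‖₁ < 1`, then `b - a` is the
logarithm of `1 - u`, which bounds its norm. -/
lemma l1_sub_le_of_exp_genFun {a b u : ℕ → ℝ} (ha : Summable fun i => |a i|)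
    (hb : Summable fun i => |b i|) (hu : Summable fun i => |u i|) (hu1 : l1 u < 1)
    (h : ∀ x : ℝ, |x| ≤ 1 → Real.exp (genFun b x - genFun a x) = 1 - genFun u x) :
    l1 (fun i => b i - a i) ≤ -Real.log (1 - l1 u) := by
  have hl := hasSum_inv_mul_pow (t := l1 u) (by rwa [abs_of_nonneg (l1_nonneg u)])
  have habs : (fun j : ℕ => |(j : ℝ)⁻¹| * l1 u ^ j) = fun j : ℕ => (j : ℝ)⁻¹ * l1 u ^ j := by
    funext j
    rw [abs_of_nonneg (by positivity)]
  have hc : Summable fun j : ℕ => |(j : ℝ)⁻¹| * l1 u ^ j := habs ▸ hl.summable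
  have hab : Summable fun i => |a i - b i| := (ha.of_abs.sub hb.of_abs).abs
  have heq : (fun i => a i - b i) = convSeries (fun j : ℕ => (j : ℝ)⁻¹) u := by
    refine eq_of_genFun_eq hab (summable_convSeries hu hc) fun x hx => ?_
    rw [genFun_sub ha hb hx, genFun_convSeries hu hc hx,
      (hasSum_inv_mul_pow ((abs_genFun_le hu hx).trans_lt hu1)).tsum_eq, ← h x hx, Real.log_exp]
    ring
  have hsymm : l1 (fun i => b i - a i) = l1 (fun i => a i - b i) := by
    simp only [l1, abs_sub_comm]
  rw [hsymm, heq, ← hl.tsum_eq, ← habs]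
  exact l1_convSeries_le hu hc

/-- Stability of the exponential in the convolution algebra `ℓ¹`. -/
lemma l1_sub_le_of_expSeq {a b : ℕ → ℝ} (ha : Summable fun i => |a i|)
    (hb : Summable fun i => |b i|)
    (hsmall : l1 (expSeq fun i => -a i) * l1 (fun i => expSeq b i - expSeq a i) < 1) :
    l1 (fun i => b i - a i) ≤
      l1 (expSeq fun i => -a i) * l1 (fun i => expSeq b i - expSeq a i) /
        (1 - l1 (expSeq fun i => -a i) * l1 (fun i => expSeq b i - expSeq a i)) := by
  set ε := l1 (expSeq fun i => -a i) * l1 (fun i => expSeq b i - expSeq a i)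
  have hna : Summable fun i => |-a i| := by simpa only [abs_neg] using ha
  have hd : Summable fun i => |expSeq a i - expSeq b i| :=
    ((summable_expSeq ha).of_abs.sub (summable_expSeq hb).of_abs).abs
  have hr := summable_expSeq hna
  have hle : l1 (conv (expSeq fun i => -a i) fun i => expSeq a i - expSeq b i) ≤ ε := by
    refine (l1_conv_le hr hd).trans_eq ?_
    simp only [ε, l1, abs_sub_comm]
  have hmain := l1_sub_le_of_exp_genFun ha hb (summable_conv hr hd) (hle.trans_lt hsmall)
    fun x hx => by
      rw [genFun_conv hr hd hx, genFun_sub (summable_expSeq ha) (summable_expSeq hb) hx,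
        genFun_expSeq hna hx, genFun_expSeq ha hx, genFun_expSeq hb hx, genFun_neg, mul_sub,
        ← Real.exp_add, ← Real.exp_add, neg_add_cancel, Real.exp_zero, sub_sub_cancel,
        neg_add_eq_sub]
  have hpos : 0 < 1 - ε := sub_pos.2 hsmall
  calc _ ≤ _ := hmain
    _ ≤ -Real.log (1 - ε) := neg_le_neg (Real.log_le_log hpos (by linarith))
    _ ≤ (1 - ε)⁻¹ - 1 := by linarith [Real.one_sub_inv_le_log_of_pos hpos]
    _ = ε / (1 - ε) := by field_simp; ring

lemma IsPMF.summable {p : ℕ → ℝ} (hp : IsPMF p) : Summable p := by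
  by_contra h
  simpa [tsum_eq_zero_of_not_summable h] using hp.2

lemma l1_eq_abs_zero_add {a : ℕ → ℝ} (ha : Summable fun i => |a i|) :
    l1 a = |a 0| + ∑' i, |a (i + 1)| :=
  ha.tsum_eq_zero_add

/-- The stability estimate: if ‖q′ − q‖₁ < 1/‖r‖₁ then
|λ′ − λ| + ‖λ′p′ − λp‖₁ ≤ ‖r‖₁‖q′ − q‖₁/(1 − ‖r‖₁‖q′ − q‖₁), and in particular the same
bound holds for ‖λ′p′ − λp‖₁ alone. -/
theorem stmt2 (lam lam' : ℝ) (hlam : 0 < lam) (hlam' : 0 < lam')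
    (p p' : ℕ → ℝ) (hp : IsPMF p) (hp' : IsPMF p') (h0 : p 0 = 0) (h0' : p' 0 = 0)
    (hsmall : l1 (fun i => expSeq (fun j => lam' * (p' j - delta0 j)) i -
        expSeq (fun j => lam * (p j - delta0 j)) i) <
      1 / l1 (expSeq (fun j => -(lam * (p j - delta0 j))))) :
    |lam' - lam| + l1 (fun i => lam' * p' i - lam * p i) ≤
      l1 (expSeq (fun j => -(lam * (p j - delta0 j)))) *
        l1 (fun i => expSeq (fun j => lam' * (p' j - delta0 j)) i -
          expSeq (fun j => lam * (p j - delta0 j)) i) /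
      (1 - l1 (expSeq (fun j => -(lam * (p j - delta0 j)))) *
        l1 (fun i => expSeq (fun j => lam' * (p' j - delta0 j)) i -
          expSeq (fun j => lam * (p j - delta0 j)) i)) ∧
    l1 (fun i => lam' * p' i - lam * p i) ≤
      l1 (expSeq (fun j => -(lam * (p j - delta0 j)))) *
        l1 (fun i => expSeq (fun j => lam' * (p' j - delta0 j)) i -
          expSeq (fun j => lam * (p j - delta0 j)) i) /
      (1 - l1 (expSeq (fun j => -(lam * (p j - delta0 j)))) *
        l1 (fun i => expSeq (fun j => lam' * (p' j - delta0 j)) i -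
          expSeq (fun j => lam * (p j - delta0 j)) i)) := by
  have hsum : ∀ {μ : ℝ} {s : ℕ → ℝ}, IsPMF s → Summable fun j => |μ * (s j - delta0 j)| :=
    fun hs => ((hs.summable.sub summable_abs_delta0.of_abs).mul_left _).abs
  have ha := hsum (μ := lam) hp
  have hb := hsum (μ := lam') hp'
  have hdiff : Summable fun i => |lam' * p' i - lam * p i| :=
    ((hp'.summable.mul_left _).sub (hp.summable.mul_left _)).abs
  have hlt : l1 (expSeq (fun j => -(lam * (p j - delta0 j)))) *
      l1 (fun i => expSeq (fun j => lam' * (p' j - delta0 j)) i -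
        expSeq (fun j => lam * (p j - delta0 j)) i) < 1 := by
    rcases (l1_nonneg (expSeq (fun j => -(lam * (p j - delta0 j))))).eq_or_lt with h | h
    · rw [← h, zero_mul]
      exact one_pos
    · rwa [lt_div_iff₀' h] at hsmall
  have hsplit : l1 (fun i => lam' * (p' i - delta0 i) - lam * (p i - delta0 i)) =
      |lam' - lam| + l1 (fun i => lam' * p' i - lam * p i) := by
    rw [l1_eq_abs_zero_add (hb.of_abs.sub ha.of_abs).abs, l1_eq_abs_zero_add hdiff]
    simp [h0, h0', delta0, neg_add_eq_sub, abs_sub_comm lam lam']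
  have hmain := hsplit ▸ l1_sub_le_of_expSeq ha hb hlt
  exact ⟨hmain, (le_add_of_nonneg_left (abs_nonneg _)).trans hmain⟩
end
end

section
/- Let 0 < Λ̲ ≤ Λ̄ < ∞, m ∈ ℕ with m ≥ 1, and ε > 0. Let S be the set of compound Poisson distributions q_{λ,p} with λ ∈ [Λ̲, Λ̄] and p a probability mass function supported on {1, …, m}. Then there exists a finite set F of probability mass functions on ℕ₀ with cardinality at most (⌊2Λ̄m/ε²⌋ + 1)^m · (⌊Λ̄/(2ε√Λ̲)⌋ + 1) such that for every q ∈ S there is f ∈ F with h(q, f) ≤ ε. -/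
open MeasureTheory
open scoped BigOperators Classical

noncomputable section

/-- Convolution of summable nonnegative sequences multiplies total masses. -/
lemma HasSum.conv {a b : ℕ → ℝ} {s t : ℝ} (ha0 : ∀ i, 0 ≤ a i) (hb0 : ∀ i, 0 ≤ b i)
    (ha : HasSum a s) (hb : HasSum b t) : HasSum (conv a b) (s * t) := by
  have ha' : Summable fun i => ‖a i‖ := by simpa [abs_of_nonneg (ha0 _)] using ha.summable
  have hb' : Summable fun i => ‖b i‖ := by simpa [abs_of_nonneg (hb0 _)] using hb.summable
  have hs := (summable_norm_sum_mul_range_of_summable_norm ha' hb').of_norm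
  have ht := tsum_mul_tsum_eq_tsum_sum_range_of_summable_norm ha' hb'
  rw [ha.tsum_eq, hb.tsum_eq] at ht
  rw [ht]
  exact hs.hasSum

lemma conv_nonneg {a b : ℕ → ℝ} (ha : ∀ i, 0 ≤ a i) (hb : ∀ i, 0 ≤ b i) (i : ℕ) :
    0 ≤ conv a b i :=
  Finset.sum_nonneg fun _ _ => mul_nonneg (ha _) (hb _)

lemma delta0_nonneg (i : ℕ) : 0 ≤ delta0 i := by
  unfold delta0; split_ifs <;> norm_num

lemma convPow_nonneg {u : ℕ → ℝ} (hu : ∀ i, 0 ≤ u i) (n : ℕ) : ∀ i, 0 ≤ convPow u n i := by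
  induction n with
  | zero => exact delta0_nonneg
  | succ n ih => exact conv_nonneg ih hu

lemma HasSum.convPow {u : ℕ → ℝ} {s : ℝ} (hu0 : ∀ i, 0 ≤ u i) (hu : HasSum u s) (n : ℕ) :
    HasSum (convPow u n) (s ^ n) := by
  induction n with
  | zero =>
    have h := hasSum_ite_eq (0 : ℕ) (1 : ℝ)
    rw [pow_zero]
    exact h
  | succ n ih => exact pow_succ s n ▸ ih.conv (convPow_nonneg hu0 n) hu0 hu

lemma convPow_const_mul (c : ℝ) (u : ℕ → ℝ) (n : ℕ) :
    ∀ i, convPow (fun j => c * u j) n i = c ^ n * convPow u n i := by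
  induction n with
  | zero => simp [convPow]
  | succ n ih =>
    intro i
    simp only [convPow, conv, ih, Finset.mul_sum]
    exact Finset.sum_congr rfl fun k _ => by ring

lemma cpq_eq_exp_mul_expSeq (lam : ℝ) (p : ℕ → ℝ) :
    cpq lam p = fun i => Real.exp (-lam) * expSeq (fun j => lam * p j) i := by
  funext i
  simp only [cpq, expSeq, convPow_const_mul, ← tsum_mul_left]
  exact tsum_congr fun n => by ring

lemma summable_convPow_div_factorial {u : ℕ → ℝ} {s : ℝ} (hu0 : ∀ i, 0 ≤ u i)
    (hu : HasSum u s) (i : ℕ) : Summable fun n => convPow u n i / (n.factorial : ℝ) := by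
  refine (Real.summable_pow_div_factorial s).of_nonneg_of_le
    (fun n => div_nonneg (convPow_nonneg hu0 n i) (by positivity)) fun n => ?_
  gcongr
  exact le_hasSum (hu.convPow hu0 n) i fun j _ => convPow_nonneg hu0 n j

lemma expSeq_nonneg {u : ℕ → ℝ} (hu0 : ∀ i, 0 ≤ u i) (i : ℕ) : 0 ≤ expSeq u i :=
  tsum_nonneg fun n => div_nonneg (convPow_nonneg hu0 n i) (by positivity)

/-- The total mass of the convolution exponential is the exponential of the total mass. -/
lemma HasSum.expSeq {u : ℕ → ℝ} {s : ℝ} (hu0 : ∀ i, 0 ≤ u i) (hu : HasSum u s) :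
    HasSum (expSeq u) (Real.exp s) := by
  have hrow (n : ℕ) : HasSum (fun i => _root_.convPow u n i / (n.factorial : ℝ))
      (s ^ n / n.factorial) := (hu.convPow hu0 n).div_const _
  have hexp : HasSum (fun n : ℕ => s ^ n / (n.factorial : ℝ)) (Real.exp s) := by
    rw [Real.exp_eq_exp_ℝ]
    exact NormedSpace.expSeries_div_hasSum_exp s
  have hsum : Summable fun x : ℕ × ℕ => _root_.convPow u x.1 x.2 / (x.1.factorial : ℝ) := by
    refine (summable_prod_of_nonneg fun x => ?_).2 ⟨fun n => (hrow n).summable, ?_⟩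
    · exact div_nonneg (convPow_nonneg hu0 _ _) (by positivity)
    · simpa only [(hrow _).tsum_eq] using hexp.summable
  have htot := hsum.hasSum
  rw [← (htot.prod_fiberwise hrow).unique hexp]
  exact ((Equiv.prodComm ℕ ℕ).hasSum_iff.2 htot).prod_fiberwise fun i =>
    (summable_convPow_div_factorial hu0 hu i).hasSum

lemma isPMF_exp_neg_mul_expSeq {u : ℕ → ℝ} {s : ℝ} (hu0 : ∀ i, 0 ≤ u i) (hu : HasSum u s) :
    IsPMF fun i => Real.exp (-s) * expSeq u i := by
  refine ⟨fun i => mul_nonneg (Real.exp_pos _).le (expSeq_nonneg hu0 i), ?_⟩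
  rw [((hu.expSeq hu0).mul_left (Real.exp (-s))).tsum_eq, ← Real.exp_add]
  simp

/-- Convolution powers of a geometric mean are dominated by the geometric mean of the
convolution powers. -/
lemma convPow_le_sqrt_mul {u v : ℕ → ℝ} (hu0 : ∀ i, 0 ≤ u i) (hv0 : ∀ i, 0 ≤ v i) (n : ℕ) :
    ∀ i, convPow (fun j => √(u j) * √(v j)) n i ≤ √(convPow u n i) * √(convPow v n i) := by
  induction n with
  | zero =>
    intro i
    simp [convPow, Real.mul_self_sqrt (delta0_nonneg i)]
  | succ n ih =>
    intro i
    calc convPow (fun j => √(u j) * √(v j)) (n + 1) i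
        ≤ ∑ k ∈ Finset.range (i + 1), √(convPow u n k * u (i - k)) *
            √(convPow v n k * v (i - k)) := by
          rw [convPow, conv]
          refine Finset.sum_le_sum fun k _ => ?_
          rw [Real.sqrt_mul (convPow_nonneg hu0 n k), Real.sqrt_mul (convPow_nonneg hv0 n k),
            mul_mul_mul_comm]
          exact mul_le_mul_of_nonneg_right (ih k) (by positivity)
      _ ≤ _ := Real.sum_sqrt_mul_sqrt_le _
          (fun k => mul_nonneg (convPow_nonneg hu0 n k) (hu0 _))
          (fun k => mul_nonneg (convPow_nonneg hv0 n k) (hv0 _))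

lemma expSeq_le_sqrt_mul {u v : ℕ → ℝ} {a b : ℝ} (hu0 : ∀ i, 0 ≤ u i) (hv0 : ∀ i, 0 ≤ v i)
    (hu : HasSum u a) (hv : HasSum v b) (i : ℕ) :
    expSeq (fun j => √(u j) * √(v j)) i ≤ √(expSeq u i) * √(expSeq v i) := by
  have hnu (n : ℕ) : 0 ≤ convPow u n i / (n.factorial : ℝ) :=
    div_nonneg (convPow_nonneg hu0 n i) (by positivity)
  have hnv (n : ℕ) : 0 ≤ convPow v n i / (n.factorial : ℝ) :=
    div_nonneg (convPow_nonneg hv0 n i) (by positivity)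
  refine Real.tsum_le_of_sum_le (fun n => div_nonneg
    (convPow_nonneg (fun j => mul_nonneg (Real.sqrt_nonneg _) (Real.sqrt_nonneg _)) n i)
    (by positivity)) fun s => ?_
  calc ∑ n ∈ s, convPow (fun j => √(u j) * √(v j)) n i / (n.factorial : ℝ)
      ≤ ∑ n ∈ s, √(convPow u n i / n.factorial) * √(convPow v n i / n.factorial) := by
        refine Finset.sum_le_sum fun n _ => ?_
        rw [Real.sqrt_div (convPow_nonneg hu0 n i), Real.sqrt_div (convPow_nonneg hv0 n i),
          div_mul_div_comm, Real.mul_self_sqrt (by positivity)]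
        gcongr
        exact convPow_le_sqrt_mul hu0 hv0 n i
    _ ≤ √(∑ n ∈ s, convPow u n i / n.factorial) * √(∑ n ∈ s, convPow v n i / n.factorial) :=
        Real.sum_sqrt_mul_sqrt_le _ hnu hnv
    _ ≤ _ := by
        gcongr
        · exact (summable_convPow_div_factorial hu0 hu i).sum_le_tsum _ fun n _ => hnu n
        · exact (summable_convPow_div_factorial hv0 hv i).sum_le_tsum _ fun n _ => hnv n

/-- The squared Hellinger distance between compound Poisson distributions is at most the squared
Hellinger distance between their intensity sequences. -/
lemma hellSq_exp_neg_mul_expSeq_le {u v : ℕ → ℝ} {a b d : ℝ} (hu0 : ∀ i, 0 ≤ u i)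
    (hv0 : ∀ i, 0 ≤ v i) (hu : HasSum u a) (hv : HasSum v b)
    (hd : HasSum (fun i => (√(u i) - √(v i)) ^ 2) d) :
    hellSq (fun i => Real.exp (-a) * expSeq u i) (fun i => Real.exp (-b) * expSeq v i) ≤ d := by
  have hw : HasSum (fun i => √(u i) * √(v i)) ((a + b - d) / 2) := by
    refine (((hu.add hv).sub hd).div_const 2).congr_fun fun i => ?_
    linear_combination (Real.sq_sqrt (hu0 i) + Real.sq_sqrt (hv0 i)) / 2
  have hW := (hw.expSeq fun i => by positivity).mul_left (√(Real.exp (-a)) * √(Real.exp (-b)))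
  have hU := (hu.expSeq hu0).mul_left (Real.exp (-a))
  have hV := (hv.expSeq hv0).mul_left (Real.exp (-b))
  have hS := (hU.add hV).sub (hW.mul_left 2)
  have hle (i : ℕ) : (√(Real.exp (-a) * expSeq u i) - √(Real.exp (-b) * expSeq v i)) ^ 2 ≤
      Real.exp (-a) * expSeq u i + Real.exp (-b) * expSeq v i - 2 * (√(Real.exp (-a)) *
        √(Real.exp (-b)) * expSeq (fun j => √(u j) * √(v j)) i) := by
    have h1 := mul_le_mul_of_nonneg_left (expSeq_le_sqrt_mul hu0 hv0 hu hv i)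
      (show 0 ≤ √(Real.exp (-a)) * √(Real.exp (-b)) by positivity)
    have h2 := Real.sq_sqrt (mul_nonneg (Real.exp_pos (-a)).le (expSeq_nonneg hu0 i))
    have h3 := Real.sq_sqrt (mul_nonneg (Real.exp_pos (-b)).le (expSeq_nonneg hv0 i))
    rw [sub_sq, h2, h3, Real.sqrt_mul (Real.exp_pos _).le, Real.sqrt_mul (Real.exp_pos _).le]
    linarith
  have hmass : Real.exp (-a) * Real.exp a + Real.exp (-b) * Real.exp b - 2 *
      (√(Real.exp (-a)) * √(Real.exp (-b)) * Real.exp ((a + b - d) / 2)) =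
      2 - 2 * Real.exp (-d / 2) := by
    rw [← Real.exp_half, ← Real.exp_half, ← Real.exp_add, ← Real.exp_add, ← Real.exp_add,
      ← Real.exp_add]
    ring_nf
    norm_num
  calc _ ≤ _ := (hS.summable.of_nonneg_of_le (fun i => sq_nonneg _) hle).tsum_le_tsum hle hS.summable
    _ = 2 - 2 * Real.exp (-d / 2) := hS.tsum_eq.trans hmass
    _ ≤ d := by linarith [Real.add_one_le_exp (-d / 2)]

lemma exists_abs_sub_midpoint_le {A y : ℝ} (hA : 0 < A) (hy0 : 0 ≤ y) (hyA : y ≤ A) {N : ℕ}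
    (hN : 0 < N) : ∃ k : Fin N, |y - (2 * k + 1) / (2 * N) * A| ≤ A / (2 * N) := by
  have hN' : (0 : ℝ) < N := by exact_mod_cast hN
  obtain ⟨k, hk0, hk1⟩ : ∃ k : Fin N, (k : ℝ) ≤ y * N / A ∧ y * N / A ≤ k + 1 := by
    rcases lt_or_ge (y * N / A) N with h | h
    · exact ⟨⟨⌊y * N / A⌋₊, (Nat.floor_lt (by positivity)).2 h⟩, Nat.floor_le (by positivity),
        (Nat.lt_floor_add_one _).le⟩
    · refine ⟨⟨N - 1, by omega⟩, ?_, ?_⟩ <;> simp only [Nat.cast_pred hN]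
      · linarith
      · rw [sub_add_cancel, div_le_iff₀ hA]
        nlinarith
  have hy : y = y * N / A * (A / N) := by field_simp
  set z := y * N / A
  have hdiff : y - (2 * k + 1) / (2 * N) * A = (2 * (z - k) - 1) * (A / (2 * N)) := by
    rw [hy]
    field_simp
    ring
  refine ⟨k, ?_⟩
  rw [hdiff, abs_mul, abs_of_pos (show 0 < A / (2 * N) by positivity)]
  refine mul_le_of_le_one_left (by positivity) (abs_le.2 ⟨?_, ?_⟩) <;> linarith

/-- Extend a vector of `m` values by zero to a sequence supported on `{1, …, m}`. -/
def extendIcc {m : ℕ} (x : Fin m → ℝ) : ℕ → ℝ :=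
  fun i => if h : 1 ≤ i ∧ i ≤ m then x ⟨i - 1, by omega⟩ else 0

/-- Covering (entropy) bound: the set of compound Poisson distributions q_{λ,p}
with λ ∈ [Λ̲, Λ̄] and p supported on {1,…,m} admits an ε-net for the Hellinger distance of
cardinality at most (⌊2Λ̄m/ε²⌋+1)^m · (⌊Λ̄/(2ε√Λ̲)⌋+1). -/
theorem stmt4 (Λlo Λhi : ℝ) (h1 : 0 < Λlo) (h2 : Λlo ≤ Λhi) (m : ℕ) (hm : 1 ≤ m)
    (ε : ℝ) (hε : 0 < ε) :
    ∃ F : Finset (ℕ → ℝ), (∀ f ∈ F, IsPMF f) ∧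
      F.card ≤ (Nat.floor (2 * Λhi * m / ε ^ 2) + 1) ^ m *
        (Nat.floor (Λhi / (2 * ε * Real.sqrt Λlo)) + 1) ∧
      ∀ lam p, lam ∈ Set.Icc Λlo Λhi → IsPMF p → p 0 = 0 → (∀ i, m < i → p i = 0) →
        ∃ f ∈ F, hell (cpq lam p) f ≤ ε := by
  have hΛ : 0 < Λhi := h1.trans_le h2
  set N : ℕ := Nat.floor (2 * Λhi * m / ε ^ 2) + 1 with hN
  have hNpos : 0 < N := Nat.succ_pos _
  have hNr : (0 : ℝ) < N := by exact_mod_cast hNpos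
  let c : Fin N → ℝ := fun k => (2 * k + 1) / (2 * N) * √Λhi
  have hc (k : Fin N) : 0 ≤ c k := by positivity
  let u : (Fin m → Fin N) → ℕ → ℝ := fun κ => extendIcc fun j => c (κ j) ^ 2
  have hu0 (κ : Fin m → Fin N) (i : ℕ) : 0 ≤ u κ i := by
    simp only [u, extendIcc]
    split_ifs <;> positivity
  have hu (κ : Fin m → Fin N) : HasSum (u κ) (∑ i ∈ Finset.Icc 1 m, u κ i) :=
    hasSum_sum_of_ne_finset_zero fun i hi => dif_neg (by simpa using hi)
  refine ⟨Finset.univ.image fun κ i =>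
    Real.exp (-∑ i ∈ Finset.Icc 1 m, u κ i) * expSeq (u κ) i, ?_, ?_, ?_⟩
  · intro f hf
    obtain ⟨κ, -, rfl⟩ := Finset.mem_image.1 hf
    exact isPMF_exp_neg_mul_expSeq (hu0 κ) (hu κ)
  · refine Finset.card_image_le.trans ?_
    simpa using Nat.le_mul_of_pos_right (N ^ m) (Nat.succ_pos _)
  · intro lam p hlam hp hp0 hpm
    have hlam0 : 0 ≤ lam := h1.le.trans hlam.1
    have hps : HasSum p 1 := by
      have hs : Summable p := by
        by_contra h
        exact zero_ne_one ((tsum_eq_zero_of_not_summable h).symm.trans hp.2)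
      exact hp.2 ▸ hs.hasSum
    have hv : HasSum (fun j => lam * p j) lam := by simpa using hps.mul_left lam
    have hv0 (i : ℕ) : 0 ≤ lam * p i := mul_nonneg hlam0 (hp.1 i)
    have hvle (i : ℕ) : √(lam * p i) ≤ √Λhi :=
      Real.sqrt_le_sqrt ((le_hasSum hv i fun j _ => hv0 j).trans hlam.2)
    choose κ hκ using fun j : Fin m => exists_abs_sub_midpoint_le (Real.sqrt_pos.2 hΛ)
      (Real.sqrt_nonneg (lam * p (j + 1))) (hvle (j + 1)) hNpos
    refine ⟨_, Finset.mem_image_of_mem _ (Finset.mem_univ κ), ?_⟩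
    rw [hell, Real.sqrt_le_left hε.le, cpq_eq_exp_mul_expSeq]
    have hd : HasSum (fun i => (√(lam * p i) - √(u κ i)) ^ 2)
        (∑ i ∈ Finset.Icc 1 m, (√(lam * p i) - √(u κ i)) ^ 2) := by
      refine hasSum_sum_of_ne_finset_zero fun i hi => ?_
      have hi' : ¬(1 ≤ i ∧ i ≤ m) := by simpa using hi
      have hpi : p i = 0 := by
        rcases Nat.eq_zero_or_pos i with rfl | h
        · exact hp0
        · exact hpm i (by omega)
      simp [u, extendIcc, hi', hpi]
    refine (hellSq_exp_neg_mul_expSeq_le hv0 (hu0 κ) hv (hu κ) hd).trans ?_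
    calc ∑ i ∈ Finset.Icc 1 m, (√(lam * p i) - √(u κ i)) ^ 2
        ≤ ∑ _i ∈ Finset.Icc 1 m, (√Λhi / (2 * N)) ^ 2 := by
          refine Finset.sum_le_sum fun i hi => ?_
          have hi' := Finset.mem_Icc.1 hi
          have h := hκ ⟨i - 1, by omega⟩
          simp only [Nat.sub_add_cancel hi'.1] at h
          rw [show u κ i = c (κ ⟨i - 1, by omega⟩) ^ 2 from dif_pos hi', Real.sqrt_sq (hc _)]
          exact sq_le_sq.2 (h.trans (le_abs_self _))
      _ = m * Λhi / (4 * N ^ 2) := by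
          rw [Finset.sum_const, Nat.card_Icc, nsmul_eq_mul, div_pow, Real.sq_sqrt hΛ.le]
          simp only [Nat.add_sub_cancel]
          ring
      _ ≤ ε ^ 2 := by
          have h3 : 2 * Λhi * m / ε ^ 2 ≤ N := by
            rw [hN]; push_cast; exact (Nat.lt_floor_add_one _).le
          rw [div_le_iff₀ (by positivity)] at h3
          have h4 : (1 : ℝ) ≤ N := by exact_mod_cast hNpos
          have h5 : (N : ℝ) ≤ N ^ 2 := by nlinarith
          rw [div_le_iff₀ (by positivity)]
          nlinarith [mul_le_mul_of_nonneg_left h5 (sq_nonneg ε), sq_nonneg ε]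
end
end

section
/- There exists a universal constant C > 0 with the following property. Let ε > 0, let m ≥ 1, let p = (p₁, …, p_m) and p′ = (p′₁, …, p′_m) be points of the m-dimensional unit simplex (i.e., nonnegative entries summing to 1), and let c ∈ (0, 1) be such that min_{1 ≤ i ≤ m} p_i ≥ c. If ∑_{i=1}^m |p′_i − p_i| ≤ C ε² / (log(e/c))², then KL(p′, p) ≤ ε² and V(p′, p) ≤ ε². -/
open MeasureTheory
open scoped BigOperators Classical

noncomputable section

theorem mul_log_le_abs_sub_one {t L : ℝ} (ht : 0 ≤ t) (hL : 1 ≤ L) (hlog : Real.log t ≤ L - 1) :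
    t * Real.log t ≤ L * |t - 1| := by
  rcases le_total t 1 with h | h
  · exact (mul_nonpos_of_nonneg_of_nonpos ht (Real.log_nonpos ht h)).trans (by positivity)
  · rw [abs_of_nonneg (by linarith)]
    nlinarith [Real.log_le_sub_one_of_pos (by linarith : 0 < t),
      mul_le_mul_of_nonneg_left hlog (by linarith : 0 ≤ t - 1)]

theorem mul_log_sq_le_one_sub {t : ℝ} (ht : 0 ≤ t) (ht1 : t ≤ 1) :
    t * Real.log t ^ 2 ≤ 4 * (1 - t) := by
  rcases ht.eq_or_lt with rfl | hpos
  · norm_num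
  obtain ⟨s, hs, rfl⟩ : ∃ s : ℝ, 0 < s ∧ t = s ^ 2 :=
    ⟨√t, Real.sqrt_pos.2 hpos, (Real.sq_sqrt ht).symm⟩
  have hs1 : s ≤ 1 := by nlinarith
  have hinv : s * -Real.log s ≤ 1 - s := by
    have := mul_le_mul_of_nonneg_left (Real.one_sub_inv_le_log_of_pos hs) hs.le
    rw [mul_sub, mul_inv_cancel₀ hs.ne'] at this
    linarith
  have hnonneg : 0 ≤ s * -Real.log s :=
    mul_nonneg hs.le (neg_nonneg.2 (Real.log_nonpos hs.le hs1))
  have hsq := pow_le_pow_left₀ hnonneg hinv 2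
  rw [Real.log_pow]
  push_cast
  nlinarith

theorem mul_log_sq_le_abs_sub_one {t L : ℝ} (ht : 0 ≤ t) (hL : 1 ≤ L)
    (hlog : Real.log t ≤ L - 1) : t * Real.log t ^ 2 ≤ 4 * L ^ 2 * |t - 1| := by
  rcases le_total t 1 with h | h
  · have hL2 : 1 ≤ L ^ 2 := one_le_pow₀ hL
    rw [abs_of_nonpos (by linarith)]
    nlinarith [mul_log_sq_le_one_sub ht h]
  · have hlog0 := Real.log_nonneg h
    have hmul := mul_le_mul (mul_log_le_abs_sub_one ht hL hlog) (by linarith : Real.log t ≤ L)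
      hlog0 (by positivity)
    nlinarith [mul_nonneg (sq_nonneg L) (abs_nonneg (t - 1))]

theorem divergence_terms_le {x y c : ℝ} (hx : 0 ≤ x) (hx1 : x ≤ 1) (hc : 0 < c) (hc1 : c < 1)
    (hy : c ≤ y) :
    x * Real.log (x / y) ≤ Real.log (Real.exp 1 / c) * |x - y| ∧
      x * Real.log (x / y) ^ 2 ≤ 4 * Real.log (Real.exp 1 / c) ^ 2 * |x - y| := by
  have hy0 : 0 < y := hc.trans_le hy
  have hL : Real.log (Real.exp 1 / c) = 1 - Real.log c := by
    rw [Real.log_div (Real.exp_ne_zero 1) hc.ne', Real.log_exp]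
  have hlogc : Real.log c ≤ 0 := Real.log_nonpos hc.le hc1.le
  have ht : 0 ≤ x / y := div_nonneg hx hy0.le
  have hlog : Real.log (x / y) ≤ Real.log (Real.exp 1 / c) - 1 := by
    rw [hL]
    rcases hx.eq_or_lt with rfl | hx0
    · simpa using hlogc
    · rw [Real.log_div hx0.ne' hy0.ne']
      linarith [Real.log_nonpos hx hx1, Real.log_le_log hc hy]
  have hL1 : 1 ≤ Real.log (Real.exp 1 / c) := by linarith
  have habs : |x - y| = y * |x / y - 1| := by
    rw [← abs_of_pos hy0, ← abs_mul, abs_of_pos hy0, mul_sub, mul_div_cancel₀ _ hy0.ne', mul_one]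
  have hxt : y * (x / y) = x := mul_div_cancel₀ _ hy0.ne'
  have h1 := mul_le_mul_of_nonneg_left (mul_log_le_abs_sub_one ht hL1 hlog) hy0.le
  have h2 := mul_le_mul_of_nonneg_left (mul_log_sq_le_abs_sub_one ht hL1 hlog) hy0.le
  rw [← mul_assoc, hxt] at h1 h2
  rw [habs]
  exact ⟨h1.trans_eq (by ring), h2.trans_eq (by ring)⟩

/-- There is a universal constant C > 0 such that whenever p, p′ lie in the
m-simplex, min p_i ≥ c ∈ (0,1), and ∑|p′_i − p_i| ≤ Cε²/(log(e/c))², then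
KL(p′,p) ≤ ε² and V(p′,p) ≤ ε². -/
theorem stmt7 :
    ∃ C > (0 : ℝ), ∀ (ε : ℝ), 0 < ε → ∀ (m : ℕ), 1 ≤ m → ∀ (p p' : Fin m → ℝ),
      (∀ i, 0 ≤ p i) → (∑ i, p i) = 1 → (∀ i, 0 ≤ p' i) → (∑ i, p' i) = 1 →
      ∀ c : ℝ, 0 < c → c < 1 → (∀ i, c ≤ p i) →
      (∑ i, |p' i - p i|) ≤ C * ε ^ 2 / (Real.log (Real.exp 1 / c)) ^ 2 →
      (∑ i, p' i * Real.log (p' i / p i)) ≤ ε ^ 2 ∧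
      (∑ i, p' i * (Real.log (p' i / p i)) ^ 2) ≤ ε ^ 2 := by
  refine ⟨1 / 4, by norm_num, fun ε _ m _ p p' _ _ hp' hsum' c hc hc1 hcp hd => ?_⟩
  have hterm (i : Fin m) := divergence_terms_le (hp' i)
    (hsum' ▸ Finset.single_le_sum (fun j _ => hp' j) (Finset.mem_univ i)) hc hc1 (hcp i)
  have hL : 1 ≤ Real.log (Real.exp 1 / c) := by
    rw [Real.log_div (Real.exp_ne_zero 1) hc.ne', Real.log_exp]
    linarith [Real.log_nonpos hc.le hc1.le]
  set L := Real.log (Real.exp 1 / c)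
  have hS : 0 ≤ ∑ i, |p' i - p i| := Finset.sum_nonneg fun i _ => abs_nonneg _
  rw [le_div_iff₀ (by positivity)] at hd
  have hKL := Finset.sum_le_sum fun i (_ : i ∈ Finset.univ) => (hterm i).1
  have hV := Finset.sum_le_sum fun i (_ : i ∈ Finset.univ) => (hterm i).2
  rw [← Finset.mul_sum] at hKL hV
  exact ⟨by nlinarith [mul_le_mul_of_nonneg_left (by nlinarith : L ≤ L ^ 2) hS, sq_nonneg ε],
    by nlinarith⟩
end
end

section
/- Let m ≥ 2 be an integer, let 0 < α̲ and α₁, …, α_m ∈ [α̲, 1], let p₀ = (p₀₁, …, p₀_m) be a point of the m-dimensional unit simplex, let ε > 0, let η > 0 with η < ε², and assume mε < 1. Let D ⊆ ℝ^{m−1} be the set of x = (x₁,…,x_{m−1}) with x_i > 0, ∑_{i=1}^{m−1} x_i < 1, and, writing x_m = 1 − ∑_{i=1}^{m−1} x_i, such that ∑_{i=1}^m |x_i − p₀_i| ≤ 2ε and min_{1 ≤ i ≤ m} x_i ≥ η. Then (Γ(∑_{i=1}^m α_i)/∏_{i=1}^m Γ(α_i)) · ∫_D ∏_{i=1}^{m−1}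 x_i^{α_i−1} · x_m^{α_m−1} dx ≥ Γ(∑_{i=1}^m α_i) · exp(−m log(1/(ε² − η)) − m log(1/α̲)). -/
open MeasureTheory
open scoped BigOperators Classical

noncomputable section

/-- Extend a point x ∈ ℝ^{m−1} to the full vector (x₁,…,x_{m−1}, 1 − ∑ x_i) ∈ ℝ^m. -/
def extendSimplex (m : ℕ) (x : Fin (m - 1) → ℝ) : Fin m → ℝ :=
  fun i => if h : (i : ℕ) < m - 1 then x ⟨i, h⟩ else 1 - ∑ j, x j

lemma extendSimplex_castSucc {n : ℕ} (x : Fin n → ℝ) (j : Fin n) :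
    extendSimplex (n + 1) x j.castSucc = x j := by
  simp [extendSimplex]

lemma extendSimplex_last {n : ℕ} (x : Fin n → ℝ) :
    extendSimplex (n + 1) x (Fin.last n) = 1 - ∑ j, x j := by
  simp [extendSimplex]

lemma sum_extendSimplex {n : ℕ} (x : Fin n → ℝ) :
    ∑ i, extendSimplex (n + 1) x i = 1 := by
  simp [Fin.sum_univ_castSucc, extendSimplex_castSucc, extendSimplex_last]

lemma continuous_extendSimplex {n : ℕ} (i : Fin (n + 1)) :
    Continuous fun x : Fin n → ℝ => extendSimplex (n + 1) x i := by
  induction i using Fin.lastCases with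
  | last => simp only [extendSimplex_last]; fun_prop
  | cast j => simp only [extendSimplex_castSucc]; fun_prop

/-- In the coordinates obtained by omitting any one entry `k` of the extended point, Lebesgue
measure is still Lebesgue measure: a cube of side `δ` in these coordinates has volume `δ ^ n`. -/
lemma volume_extendSimplex_mem_cube {n : ℕ} (k : Fin (n + 1)) (a : Fin (n + 1) → ℝ) (δ : ℝ) :
    volume {x : Fin n → ℝ | ∀ i, i ≠ k → extendSimplex (n + 1) x i ∈ Set.Icc (a i) (a i + δ)} =
      ENNReal.ofReal δ ^ n := by
  induction k using Fin.lastCases with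
  | last =>
    have h : {x : Fin n → ℝ | ∀ i, i ≠ Fin.last n →
        extendSimplex (n + 1) x i ∈ Set.Icc (a i) (a i + δ)} =
        Set.Icc (fun j => a j.castSucc) (fun j => a j.castSucc + δ) := by
      ext x
      simp only [Set.mem_ofPred_eq, Fin.forall_fin_succ', extendSimplex_castSucc, Set.mem_Icc,
        Pi.le_def, ← forall_and]
      simp [Fin.castSucc_ne_last]
    rw [h, Real.volume_Icc_pi]
    simp
  | cast k =>
    let M : Matrix (Fin n) (Fin n) ℝ := (1 : Matrix (Fin n) (Fin n) ℝ).updateRow k 1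
    have hdet : M.det = 1 := by
      rw [← Matrix.det_transpose, ← Matrix.updateCol_transpose, ← Matrix.cramer_apply]
      simp
    let l : Fin n → ℝ := fun j => if j = k then 1 - a (Fin.last n) - δ else a j.castSucc
    have hM (x : Fin n → ℝ) (j : Fin n) :
        Matrix.toLin' M x j = if j = k then ∑ i, x i else x j := by
      rw [Matrix.toLin'_apply]
      split_ifs with h
      · subst h; simp [M, Matrix.mulVec, dotProduct]
      · simp [M, Matrix.mulVec, dotProduct, Matrix.updateRow_ne h, Matrix.one_apply]
    have h : {x : Fin n → ℝ | ∀ i, i ≠ k.castSucc →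
        extendSimplex (n + 1) x i ∈ Set.Icc (a i) (a i + δ)} =
        Matrix.toLin' M ⁻¹' Set.Icc l (fun j => l j + δ) := by
      ext x
      simp only [Set.mem_ofPred_eq, Fin.forall_fin_succ', extendSimplex_castSucc, Set.mem_Icc,
        Pi.le_def, ← forall_and, Set.mem_preimage, extendSimplex_last, hM, l]
      constructor
      · rintro ⟨h1, h2⟩ j
        by_cases hj : j = k
        · have := h2 (Fin.castSucc_ne_last k).symm
          simp only [hj, if_true]
          constructor <;> linarith
        · simpa [hj] using h1 j (by simpa using hj)
      · intro h
        refine ⟨fun j hj => ?_, fun _ => ?_⟩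
        · have hj' : j ≠ k := by simpa using hj
          simpa [hj'] using h j
        · have := h k
          simp only [if_true] at this
          constructor <;> linarith
    rw [h, Measure.addHaar_preimage_linearMap _ (by simp [hdet]), LinearMap.det_toLin', hdet,
      Real.volume_Icc_pi]
    simp

/-- If all coordinates of a point of the simplex but one of the largest exceed those of `p₀`
by an amount between `η` and `ε ^ 2`, then the point is `2 * ε`-close to `p₀` in `ℓ¹`
and has all coordinates at least `η`. -/
lemma sum_abs_sub_le_and_forall_le {ι : Type*} [Fintype ι] {p₀ e : ι → ℝ} {ε η : ℝ} {k : ι}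
    (hp₀ : ∀ i, 0 ≤ p₀ i) (hp₀s : ∑ i, p₀ i = 1) (hes : ∑ i, e i = 1) (hε : 0 < ε)
    (hη : 0 < η) (hηε : η < ε ^ 2) (hιε : (Fintype.card ι : ℝ) * ε < 1)
    (hk : 1 ≤ Fintype.card ι * p₀ k)
    (he : ∀ i, i ≠ k → e i ∈ Set.Icc (p₀ i + η) (p₀ i + ε ^ 2)) :
    ∑ i, |e i - p₀ i| ≤ 2 * ε ∧ ∀ i, η ≤ e i := by
  have hcard : ∑ i ∈ Finset.univ.erase k, ε ^ 2 = (Fintype.card ι - 1) * ε ^ 2 := by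
    rw [Finset.sum_const, Finset.card_erase_of_mem (Finset.mem_univ k), Finset.card_univ,
      nsmul_eq_mul, Nat.cast_sub (Fintype.card_pos_iff.2 ⟨k⟩), Nat.cast_one]
  have hcε : (Fintype.card ι - 1) * ε ^ 2 ≤ ε - ε ^ 2 := by nlinarith
  have habs (i) (hi : i ≠ k) : |e i - p₀ i| = e i - p₀ i :=
    abs_of_nonneg (by linarith [(he i hi).1])
  have hsum : ∑ i ∈ Finset.univ.erase k, (e i - p₀ i) ≤ ε - ε ^ 2 := by
    refine le_trans ?_ hcε
    rw [← hcard]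
    exact Finset.sum_le_sum fun i hi => by linarith [(he i (Finset.ne_of_mem_erase hi)).2]
  have hsum0 : 0 ≤ ∑ i ∈ Finset.univ.erase k, (e i - p₀ i) :=
    Finset.sum_nonneg fun i hi => by linarith [(he i (Finset.ne_of_mem_erase hi)).1]
  have hek : e k - p₀ k = -∑ i ∈ Finset.univ.erase k, (e i - p₀ i) := by
    have := Finset.add_sum_erase Finset.univ (fun i => e i - p₀ i) (Finset.mem_univ k)
    simp only [Finset.sum_sub_distrib, hes, hp₀s] at this ⊢
    linarith
  have hpk : ε ≤ p₀ k := by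
    have : (0 : ℝ) < Fintype.card ι := by exact_mod_cast Fintype.card_pos_iff.2 ⟨k⟩
    exact le_of_mul_le_mul_left (by linarith) this
  constructor
  · rw [← Finset.add_sum_erase _ _ (Finset.mem_univ k),
      Finset.sum_congr rfl fun i hi => habs i (Finset.ne_of_mem_erase hi), hek, abs_neg,
      abs_of_nonneg hsum0]
    nlinarith
  · intro i
    by_cases hi : i = k
    · subst hi; linarith
    · linarith [(he i hi).1, hp₀ i]

lemma one_le_card_mul_of_sum_eq_one {ι : Type*} [Fintype ι] {p : ι → ℝ}
    (hp : ∑ i, p i = 1) : ∃ k, 1 ≤ Fintype.card ι * p k := by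
  by_contra! h
  have hne : (Finset.univ : Finset ι).Nonempty := by
    by_contra h0
    simp [Finset.not_nonempty_iff_eq_empty.1 h0] at hp
  have := Finset.sum_lt_sum_of_nonempty hne fun i _ => h i
  simp [← Finset.mul_sum, hp] at this

lemma Real.Gamma_le_inv {a : ℝ} (h0 : 0 < a) (h1 : a ≤ 1) : Real.Gamma a ≤ a⁻¹ := by
  have h : Real.Gamma (a + 1) ≤ 1 := by
    have := Real.convexOn_Gamma.2 (Set.mem_Ioi.2 one_pos) (Set.mem_Ioi.2 two_pos)
      (sub_nonneg.2 h1) h0.le (sub_add_cancel 1 a)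
    simp only [smul_eq_mul, Real.Gamma_one, Real.Gamma_two] at this
    rw [show (1 - a) * 1 + a * 2 = a + 1 by ring] at this
    linarith
  rw [Real.Gamma_add_one h0.ne'] at h
  rw [← one_div, le_div_iff₀ h0]
  linarith

/-- The truncated `ℓ¹`-neighbourhood of `p₀` in the simplex, parametrised by all coordinates
but the last. -/
def simplexNhd {n : ℕ} (p₀ : Fin (n + 1) → ℝ) (ε η : ℝ) : Set (Fin n → ℝ) :=
  {x | (∀ j, 0 < x j) ∧ (∑ j, x j) < 1 ∧
    (∑ i, |extendSimplex (n + 1) x i - p₀ i|) ≤ 2 * ε ∧ (∀ i, η ≤ extendSimplex (n + 1) x i)}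

lemma measurableSet_simplexNhd {n : ℕ} (p₀ : Fin (n + 1) → ℝ) (ε η : ℝ) :
    MeasurableSet (simplexNhd p₀ ε η) := by
  have hc := continuous_extendSimplex (n := n)
  simp only [simplexNhd, Set.ofPred_and, Set.ofPred_forall]
  refine .inter (.iInter fun j => ?_) (.inter ?_ (.inter ?_ (.iInter fun i => ?_)))
  · exact measurableSet_lt (by fun_prop) (by fun_prop)
  · exact measurableSet_lt (by fun_prop) (by fun_prop)
  · exact measurableSet_le (by fun_prop) (by fun_prop)
  · exact measurableSet_le (by fun_prop) (by fun_prop)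

lemma volume_simplexNhd_lt_top {n : ℕ} (p₀ : Fin (n + 1) → ℝ) (ε η : ℝ) :
    volume (simplexNhd p₀ ε η) < ⊤ := by
  refine (measure_mono (t := Set.Icc 0 1) fun x hx => ?_).trans_lt isCompact_Icc.measure_lt_top
  exact ⟨fun j => (hx.1 j).le, fun j =>
    (Finset.single_le_sum (fun i _ => (hx.1 i).le) (Finset.mem_univ j)).trans hx.2.1.le⟩

lemma extendSimplex_le_one_of_mem_simplexNhd {n : ℕ} {p₀ : Fin (n + 1) → ℝ} {ε η : ℝ}
    (hη : 0 < η) {x : Fin n → ℝ} (hx : x ∈ simplexNhd p₀ ε η) (i : Fin (n + 1)) :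
    extendSimplex (n + 1) x i ≤ 1 := by
  rw [← sum_extendSimplex x]
  exact Finset.single_le_sum (fun i _ => hη.le.trans (hx.2.2.2 i)) (Finset.mem_univ i)

lemma pow_le_volume_simplexNhd {n : ℕ} {p₀ : Fin (n + 1) → ℝ} (hp₀ : ∀ i, 0 ≤ p₀ i)
    (hp₀s : ∑ i, p₀ i = 1) {ε η : ℝ} (hε : 0 < ε) (hη : 0 < η) (hηε : η < ε ^ 2)
    (hmε : ((n + 1 : ℕ) : ℝ) * ε < 1) :
    (ε ^ 2 - η) ^ n ≤ volume.real (simplexNhd p₀ ε η) := by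
  obtain ⟨k, hk⟩ := one_le_card_mul_of_sum_eq_one hp₀s
  have hsub : {x : Fin n → ℝ | ∀ i, i ≠ k → extendSimplex (n + 1) x i ∈
      Set.Icc (p₀ i + η) (p₀ i + η + (ε ^ 2 - η))} ⊆ simplexNhd p₀ ε η := by
    intro x hx
    obtain ⟨h1, h2⟩ := sum_abs_sub_le_and_forall_le hp₀ hp₀s (sum_extendSimplex x) hε hη hηε
      (by simpa using hmε) hk fun i hi => by simpa [add_assoc] using hx i hi
    refine ⟨fun j => ?_, ?_, h1, h2⟩
    · simpa [extendSimplex_castSucc] using hη.trans_le (h2 j.castSucc)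
    · have := hη.trans_le (h2 (Fin.last n))
      rw [extendSimplex_last] at this
      linarith
  have := measureReal_mono hsub (volume_simplexNhd_lt_top p₀ ε η).ne
  rwa [measureReal_def, volume_extendSimplex_mem_cube, ENNReal.toReal_pow,
    ENNReal.toReal_ofReal (by linarith)] at this

lemma volume_simplexNhd_le_setIntegral {n : ℕ} (p₀ : Fin (n + 1) → ℝ) (ε : ℝ) {η : ℝ}
    (hη : 0 < η) {α : Fin (n + 1) → ℝ} (hα : ∀ i, α i ≤ 1) :
    volume.real (simplexNhd p₀ ε η) ≤
      ∫ x in simplexNhd p₀ ε η, ∏ i, extendSimplex (n + 1) x i ^ (α i - 1) := by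
  have hS := measurableSet_simplexNhd p₀ ε η
  have hfin := volume_simplexNhd_lt_top p₀ ε η
  have hpos {x} (hx : x ∈ simplexNhd p₀ ε η) (i) : 0 < extendSimplex (n + 1) x i :=
    hη.trans_le (hx.2.2.2 i)
  have hint : IntegrableOn (fun x : Fin n → ℝ => ∏ i, extendSimplex (n + 1) x i ^ (α i - 1))
      (simplexNhd p₀ ε η) := by
    refine Measure.integrableOn_of_bounded (M := ∏ i, η ^ (α i - 1)) hfin.ne ?_ ?_
    · have hm i := (continuous_extendSimplex (n := n) i).measurable
      exact (Finset.measurable_prod _ fun i _ => (hm i).pow_const _).aestronglyMeasurable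
    · filter_upwards [ae_restrict_mem hS] with x hx
      rw [Real.norm_of_nonneg (Finset.prod_nonneg fun i _ => Real.rpow_nonneg (hpos hx i).le _)]
      exact Finset.prod_le_prod (fun i _ => Real.rpow_nonneg (hpos hx i).le _) fun i _ =>
        Real.rpow_le_rpow_of_nonpos hη (hx.2.2.2 i) (by linarith [hα i])
  have h1 : ∫ _ in simplexNhd p₀ ε η, (1 : ℝ) = volume.real (simplexNhd p₀ ε η) := by simp
  rw [← h1]
  refine setIntegral_mono_on (integrableOn_const hfin.ne) hint hS fun x hx => ?_
  refine (Finset.prod_const_one (s := (Finset.univ : Finset (Fin (n + 1))))).symm.trans_le ?_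
  exact Finset.prod_le_prod (fun _ _ => zero_le_one) fun i _ =>
    Real.one_le_rpow_of_pos_of_le_one_of_nonpos (hpos hx i)
      (extendSimplex_le_one_of_mem_simplexNhd hη hx i) (by linarith [hα i])

/-- Lower bound on the Dirichlet probability of the set
{p : ∑|p_i − p₀_i| ≤ 2ε, min p_i ≥ η}. -/
theorem stmt8 (m : ℕ) (hm : 2 ≤ m) (αlo : ℝ) (hαlo : 0 < αlo) (α : Fin m → ℝ)
    (hα : ∀ i, αlo ≤ α i ∧ α i ≤ 1) (p₀ : Fin m → ℝ) (hp₀ : ∀ i, 0 ≤ p₀ i)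
    (hp₀s : (∑ i, p₀ i) = 1) (ε η : ℝ) (hε : 0 < ε) (hη : 0 < η) (hηε : η < ε ^ 2)
    (hmε : (m : ℝ) * ε < 1) :
    Real.Gamma (∑ i, α i) *
        Real.exp (-(m : ℝ) * Real.log (1 / (ε ^ 2 - η)) - (m : ℝ) * Real.log (1 / αlo)) ≤
      (Real.Gamma (∑ i, α i) / ∏ i, Real.Gamma (α i)) *
        ∫ x in {x : Fin (m - 1) → ℝ | (∀ j, 0 < x j) ∧ (∑ j, x j) < 1 ∧
            (∑ i, |extendSimplex m x i - p₀ i|) ≤ 2 * ε ∧ (∀ i, η ≤ extendSimplex m x i)},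
          ∏ i, extendSimplex m x i ^ (α i - 1) := by
  obtain ⟨n, rfl⟩ : ∃ n, m = n + 1 := ⟨m - 1, by omega⟩
  change _ ≤ _ * ∫ x in simplexNhd p₀ ε η, ∏ i, extendSimplex (n + 1) x i ^ (α i - 1)
  have hδ : 0 < ε ^ 2 - η := by linarith
  have hδ1 : ε ^ 2 - η ≤ 1 := by
    have : (1 : ℝ) ≤ ((n + 1 : ℕ) : ℝ) := by exact_mod_cast Nat.le_add_left 1 n
    nlinarith
  have hαpos (i) : 0 < α i := hαlo.trans_le (hα i).1
  have hΓpos (i) : 0 < Real.Gamma (α i) := Real.Gamma_pos_of_pos (hαpos i)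
  have hexp : Real.exp (-((n + 1 : ℕ) : ℝ) * Real.log (1 / (ε ^ 2 - η)) -
      ((n + 1 : ℕ) : ℝ) * Real.log (1 / αlo)) = (ε ^ 2 - η) ^ (n + 1) * αlo ^ (n + 1) := by
    rw [one_div, one_div, Real.log_inv, Real.log_inv, neg_mul_neg, mul_neg, sub_neg_eq_add,
      Real.exp_add, Real.exp_nat_mul, Real.exp_nat_mul, Real.exp_log hδ, Real.exp_log hαlo]
  have hΓ : αlo ^ (n + 1) ≤ (∏ i, Real.Gamma (α i))⁻¹ := by
    rw [← Finset.prod_inv_distrib]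
    have : αlo ^ (n + 1) = ∏ _i : Fin (n + 1), αlo := by simp
    rw [this]
    refine Finset.prod_le_prod (fun _ _ => hαlo.le) fun i _ => (hα i).1.trans ?_
    exact le_inv_of_le_inv₀ (hΓpos i) (Real.Gamma_le_inv (hαpos i) (hα i).2)
  have hvol : (ε ^ 2 - η) ^ (n + 1) ≤
      ∫ x in simplexNhd p₀ ε η, ∏ i, extendSimplex (n + 1) x i ^ (α i - 1) :=
    (pow_le_pow_of_le_one hδ.le hδ1 n.le_succ).trans <|
      (pow_le_volume_simplexNhd hp₀ hp₀s hε hη hηε hmε).trans <|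
        volume_simplexNhd_le_setIntegral p₀ ε hη fun i => (hα i).2
  rw [hexp, div_eq_mul_inv, mul_assoc, mul_comm (_ ^ _)]
  have hΓsum : 0 ≤ Real.Gamma (∑ i, α i) :=
    (Real.Gamma_pos_of_pos (Finset.sum_pos (fun i _ => hαpos i) Finset.univ_nonempty)).le
  have hΓinv : 0 ≤ (∏ i, Real.Gamma (α i))⁻¹ :=
    inv_nonneg.2 (Finset.prod_nonneg fun i _ => (hΓpos i).le)
  gcongr
end
end

section
/- Let p, p′ : ℕ → ℝ be probability mass functions with p(0) = p′(0) = 0 such that p′(i) > 0 whenever p(i) > 0 and both KL(p, p′) and V(p, p′) are finite. Then for every n ≥ 1, V(p^{∗n}, p′^{∗n}) ≤ n · V(p, p′) + 4n · KL(p, p′) + n(n−1) · KL(p, p′)². -/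
open MeasureTheory
open scoped BigOperators Classical

noncomputable section

/-- A slope at `exp a` of a convex function lying between `x (log x)²` and
`x (log x)² + 2 (x log x - x + 1)`. -/
def supportSlope (a : ℝ) : ℝ := if 0 ≤ a then a ^ 2 + 2 * a else 2 * a

lemma exp_mul_sq_le_of_neg {a : ℝ} (ha : a < 0) :
    Real.exp a * a ^ 2 ≤ 2 * (Real.exp a * a - Real.exp a + 1) := by
  have h1 := Real.quadratic_le_exp_of_nonneg (x := -a) (by linarith)
  have h2 : Real.exp a * Real.exp (-a) = 1 := by rw [← Real.exp_add]; simp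
  nlinarith [mul_le_mul_of_nonneg_left h1 (Real.exp_pos a).le]

lemma supportSlope_line_le (a b : ℝ) :
    Real.exp a * a ^ 2 + supportSlope a * (Real.exp b - Real.exp a) ≤
      Real.exp b * b ^ 2 + 2 * (Real.exp b * b - Real.exp b + 1) := by
  have hb := Real.exp_pos b
  have hab : Real.exp b * (1 + (a - b)) ≤ Real.exp a := by
    calc Real.exp b * (1 + (a - b)) ≤ Real.exp b * Real.exp (a - b) := by
          gcongr; linarith [Real.add_one_le_exp (a - b)]
      _ = Real.exp a := by rw [← Real.exp_add]; congr 1; ring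
  have hent : 0 ≤ Real.exp b * b - Real.exp b + 1 := by
    have h1 := Real.add_one_le_exp (-b)
    have h2 : Real.exp b * Real.exp (-b) = 1 := by rw [← Real.exp_add]; simp
    nlinarith [mul_le_mul_of_nonneg_left h1 hb.le]
  unfold supportSlope
  split_ifs with ha
  · rcases le_or_gt 0 b with hb0 | hb0
    · nlinarith [mul_le_mul_of_nonneg_left hab ha, mul_nonneg hb.le (sq_nonneg (a - b))]
    · have h1 := Real.add_one_le_exp a
      have h2 : Real.exp b ≤ 1 := Real.exp_le_one_iff.2 hb0.le
      nlinarith [mul_nonneg hb.le (sq_nonneg b), mul_le_mul_of_nonneg_left h1 ha,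
        mul_le_mul_of_nonneg_left h2 ha, mul_le_mul_of_nonneg_left h2 (sq_nonneg a)]
  · have h1 := exp_mul_sq_le_of_neg (not_le.1 ha)
    nlinarith [mul_nonneg hb.le (sq_nonneg b)]

lemma exp_mul_sub_supportSlope_le (a : ℝ) :
    Real.exp a * a ^ 2 - supportSlope a * Real.exp a ≤ 2 := by
  have he := Real.exp_pos a
  unfold supportSlope
  split_ifs with ha
  · nlinarith [mul_nonneg he.le ha]
  · have h1 := exp_mul_sq_le_of_neg (not_le.1 ha)
    nlinarith

lemma mul_supportSlope_line_le {u v : ℝ} (hu : 0 ≤ u) (hv : 0 ≤ v) (huv : 0 < u → 0 < v)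
    (a : ℝ) :
    v * (Real.exp a * a ^ 2) + supportSlope a * (u - v * Real.exp a) ≤
      u * Real.log (u / v) ^ 2 + 2 * (u * Real.log (u / v) - u + v) := by
  rcases hu.eq_or_lt with rfl | hu
  · nlinarith [mul_le_mul_of_nonneg_left (exp_mul_sub_supportSlope_le a) hv]
  · have hv := huv hu
    have he : u = v * Real.exp (Real.log (u / v)) := by
      rw [Real.exp_log (div_pos hu hv)]; field_simp
    have h := mul_le_mul_of_nonneg_left (supportSlope_line_le a (Real.log (u / v))) hv.le
    generalize Real.log (u / v) = b at *
    subst he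
    linarith

lemma entropy_term_nonneg {u v : ℝ} (hu : 0 ≤ u) (hv : 0 ≤ v) (huv : 0 < u → 0 < v) :
    0 ≤ u * Real.log (u / v) - u + v := by
  rcases hu.eq_or_lt with rfl | hu
  · simpa using hv
  · have hv := huv hu
    have h := Real.one_sub_inv_le_log_of_pos (div_pos hu hv)
    have h2 : u * (1 - (u / v)⁻¹) = u - v := by field_simp
    nlinarith [mul_le_mul_of_nonneg_left h hu.le]

/-- `u` and `v` are probability weights with `u` dominated by `v`, and the first two moments
of `log (u / v)` under `u` are `A` and `B`. -/
structure LogMoments {X : Type} (u v : X → ℝ) (A B : ℝ) : Prop where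
  nonneg_left : ∀ x, 0 ≤ u x
  nonneg_right : ∀ x, 0 ≤ v x
  pos_of_pos : ∀ x, 0 < u x → 0 < v x
  hasSum_left : HasSum u 1
  hasSum_right : HasSum v 1
  hasSum_log : HasSum (fun x => u x * Real.log (u x / v x)) A
  hasSum_log_sq : HasSum (fun x => u x * Real.log (u x / v x) ^ 2) B

lemma hasSum_prod_mul {X Y : Type} {f : X → ℝ} {g : Y → ℝ} {s t : ℝ}
    (hf : HasSum f s) (hg : HasSum g t) :
    HasSum (fun z : X × Y => f z.1 * g z.2) (s * t) :=
  hf.mul hg (summable_mul_of_summable_norm hf.summable.norm hg.summable.norm)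

lemma mul_log_prod {a b c d : ℝ} (ha : 0 ≤ a) (hb : 0 ≤ b) (hac : 0 < a → 0 < c)
    (hbd : 0 < b → 0 < d) :
    a = 0 ∨ b = 0 ∨ Real.log (a * b / (c * d)) = Real.log (a / c) + Real.log (b / d) := by
  rcases ha.eq_or_lt with rfl | ha
  · exact Or.inl rfl
  rcases hb.eq_or_lt with rfl | hb
  · exact Or.inr (Or.inl rfl)
  refine Or.inr (Or.inr ?_)
  rw [mul_div_mul_comm, Real.log_mul (div_pos ha (hac ha)).ne' (div_pos hb (hbd hb)).ne']

namespace LogMoments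

lemma mean_nonneg {X : Type} {u v : X → ℝ} {A B : ℝ} (h : LogMoments u v A B) : 0 ≤ A := by
  have := ((h.hasSum_log.sub h.hasSum_left).add h.hasSum_right).nonneg fun x =>
    entropy_term_nonneg (h.nonneg_left x) (h.nonneg_right x) (h.pos_of_pos x)
  linarith

lemma prod {X Y : Type} {u v : X → ℝ} {u' v' : Y → ℝ} {A B A' B' : ℝ}
    (h : LogMoments u v A B) (h' : LogMoments u' v' A' B') :
    LogMoments (fun z : X × Y => u z.1 * u' z.2) (fun z => v z.1 * v' z.2)
      (A + A') (B + B' + 2 * (A * A')) where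
  nonneg_left z := mul_nonneg (h.nonneg_left _) (h'.nonneg_left _)
  nonneg_right z := mul_nonneg (h.nonneg_right _) (h'.nonneg_right _)
  pos_of_pos z hz := by
    have h1 : 0 < u z.1 :=
      (h.nonneg_left _).lt_of_ne fun e => by simp [← e] at hz
    have h2 : 0 < u' z.2 :=
      (h'.nonneg_left _).lt_of_ne fun e => by simp [← e] at hz
    exact mul_pos (h.pos_of_pos _ h1) (h'.pos_of_pos _ h2)
  hasSum_left := by simpa using hasSum_prod_mul h.hasSum_left h'.hasSum_left
  hasSum_right := by simpa using hasSum_prod_mul h.hasSum_right h'.hasSum_right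
  hasSum_log := by
    have := (hasSum_prod_mul h.hasSum_log h'.hasSum_left).add
      (hasSum_prod_mul h.hasSum_left h'.hasSum_log)
    rw [mul_one, one_mul] at this
    refine this.congr_fun fun z => ?_
    rcases mul_log_prod (h.nonneg_left z.1) (h'.nonneg_left z.2) (h.pos_of_pos z.1)
      (h'.pos_of_pos z.2) with e | e | e
    · simp [e]
    · simp [e]
    · simp only [e]; ring
  hasSum_log_sq := by
    have := ((hasSum_prod_mul h.hasSum_log_sq h'.hasSum_left).add
      (hasSum_prod_mul h.hasSum_left h'.hasSum_log_sq)).add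
      ((hasSum_prod_mul h.hasSum_log h'.hasSum_log).mul_left 2)
    rw [mul_one, one_mul] at this
    refine this.congr_fun fun z => ?_
    rcases mul_log_prod (h.nonneg_left z.1) (h'.nonneg_left z.2) (h.pos_of_pos z.1)
      (h'.pos_of_pos z.2) with e | e | e
    · simp [e]
    · simp [e]
    · simp only [e]; ring

/-- Pushing weights forward along `S` increases the second log-moment by at most `2 A`. -/
lemma Vd_map_le {X : Type} {u v : X → ℝ} {A B : ℝ} (h : LogMoments u v A B) (S : X → ℕ)
    {a b : ℕ → ℝ} (ha : ∀ i, HasSum (fun x : S ⁻¹' {i} => u x) (a i))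
    (hb : ∀ i, HasSum (fun x : S ⁻¹' {i} => v x) (b i)) :
    Vd a b ≤ B + 2 * A := by
  have hF := h.hasSum_log_sq.add
    (((h.hasSum_log.sub h.hasSum_left).add h.hasSum_right).mul_left 2)
  rw [sub_add_cancel] at hF
  set F : X → ℝ := fun x => u x * Real.log (u x / v x) ^ 2 +
    2 * (u x * Real.log (u x / v x) - u x + v x)
  have hF0 : ∀ x, 0 ≤ F x := fun x => add_nonneg
    (mul_nonneg (h.nonneg_left x) (sq_nonneg _)) (mul_nonneg zero_le_two
      (entropy_term_nonneg (h.nonneg_left x) (h.nonneg_right x) (h.pos_of_pos x)))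
  have hfib := hF.tsum_fiberwise S
  have ha0 : ∀ i, 0 ≤ a i := fun i => (ha i).nonneg (fun x : S ⁻¹' {i} => h.nonneg_left x)
  have key : ∀ i, a i * Real.log (a i / b i) ^ 2 ≤ ∑' x : S ⁻¹' {i}, F x := by
    intro i
    rcases (ha0 i).eq_or_lt with hai | hai
    · rw [← hai, zero_mul]
      exact tsum_nonneg fun x => hF0 x
    have hbi : 0 < b i := by
      by_contra hcon
      have hbi : b i = 0 :=
        le_antisymm (not_lt.1 hcon) ((hb i).nonneg (fun x : S ⁻¹' {i} => h.nonneg_right x))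
      have hv : ∀ x : S ⁻¹' {i}, v x = 0 := fun x => le_antisymm
        (hbi ▸ le_hasSum (hb i) x fun y _ => h.nonneg_right y) (h.nonneg_right x)
      have hu : ∀ x : S ⁻¹' {i}, u x = 0 := fun x =>
        ((h.nonneg_left x).eq_or_lt.resolve_right fun hx =>
          (h.pos_of_pos x hx).ne' (hv x)).symm
      have := (ha i).unique ((hasSum_zero).congr_fun hu)
      exact hai.ne' this
    have hline := ((hb i).mul_right (Real.exp (Real.log (a i / b i)) *
      Real.log (a i / b i) ^ 2)).add (((ha i).sub ((hb i).mul_right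
      (Real.exp (Real.log (a i / b i))))).mul_left (supportSlope (Real.log (a i / b i))))
    have hle := hasSum_le (fun x : S ⁻¹' {i} => mul_supportSlope_line_le (h.nonneg_left x)
      (h.nonneg_right x) (h.pos_of_pos x) (Real.log (a i / b i))) hline
      (hF.summable.subtype (S ⁻¹' {i})).hasSum
    have he : b i * Real.exp (Real.log (a i / b i)) = a i := by
      rw [Real.exp_log (div_pos hai hbi)]; field_simp
    rw [← mul_assoc, he, sub_self, mul_zero, add_zero] at hle
    exact hle
  have hs : Summable fun i => a i * Real.log (a i / b i) ^ 2 :=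
    hfib.summable.of_nonneg_of_le (fun i => mul_nonneg (ha0 i) (sq_nonneg _)) key
  have h1 := hasSum_le key hs.hasSum hfib
  simpa [Vd] using h1

end LogMoments

lemma hasSum_fiber_conv {X : Type} {u : X → ℝ} {S : X → ℕ} {a p : ℕ → ℝ}
    (h : ∀ i, HasSum (fun x : S ⁻¹' {i} => u x) (a i)) (i : ℕ) :
    HasSum (fun z : (fun z : X × ℕ => S z.1 + z.2) ⁻¹' {i} => u z.1.1 * p z.1.2)
      (conv a p i) := by
  have hind : ∀ j, HasSum ((S ⁻¹' {j}).indicator u) (a j) := fun j =>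
    hasSum_subtype_iff_indicator.1 (h j)
  have hsum := hasSum_sum (s := Finset.range (i + 1)) fun j _ =>
    hasSum_prod_mul (hind j) (hasSum_ite_eq (i - j) (p (i - j)))
  refine (hasSum_subtype_iff_indicator (f := fun z : X × ℕ => u z.1 * p z.2)).2
    (hsum.congr_fun fun z => ?_)
  obtain ⟨x, k⟩ := z
  simp only [Set.indicator_apply, Set.mem_preimage, Set.mem_singleton_iff]
  split_ifs with hz
  · rw [Finset.sum_eq_single (S x)]
    · have : k = i - S x := by omega
      simp [this]
    · intro j _ hj
      rw [if_neg (Ne.symm hj), zero_mul]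
    · intro hj
      exact absurd (Finset.mem_range.2 (by omega)) hj
  · symm
    refine Finset.sum_eq_zero fun j hj => ?_
    have := Finset.mem_range.1 hj
    by_cases h1 : S x = j
    · rw [if_neg (c := k = i - j) (by omega), mul_zero]
    · rw [if_neg h1, zero_mul]

lemma IsPMF.hasSum {p : ℕ → ℝ} (hp : IsPMF p) : HasSum p 1 := by
  have hs : Summable p := by
    by_contra h
    have := hp.2
    rw [tsum_eq_zero_of_not_summable h] at this
    exact zero_ne_one this
  exact hp.2 ▸ hs.hasSum

/-- Convolution powers are realised as laws of a sum on a common product space. -/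
lemma exists_logMoments_convPow {p q : ℕ → ℝ} {K V : ℝ} (h : LogMoments p q K V) (n : ℕ) :
    ∃ (X : Type) (u v : X → ℝ) (S : X → ℕ),
      LogMoments u v (n * K) (n * V + n * (n - 1 : ℝ) * K ^ 2) ∧
      (∀ i, HasSum (fun x : S ⁻¹' {i} => u x) (convPow p n i)) ∧
      ∀ i, HasSum (fun x : S ⁻¹' {i} => v x) (convPow q n i) := by
  induction n with
  | zero =>
    have hd : ∀ i, HasSum (fun _ : (fun _ : Unit => 0) ⁻¹' {i} => (1 : ℝ)) (delta0 i) := by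
      intro i
      refine (hasSum_subtype_iff_indicator (f := fun _ : Unit => (1 : ℝ))).2 ?_
      convert hasSum_unique (β := Unit) _ using 1
      simp [delta0, Set.indicator_apply, eq_comm]
    refine ⟨Unit, fun _ => 1, fun _ => 1, fun _ => 0, ?_, hd, hd⟩
    have h1 : HasSum (fun _ : Unit => (1 : ℝ)) 1 := hasSum_unique _
    exact ⟨by simp, by simp, by simp, h1, h1, by simp, by simp⟩
  | succ n ih =>
    obtain ⟨X, u, v, S, hm, hu, hv⟩ := ih
    have hprod := hm.prod h
    rw [show (n : ℝ) * K + K = (n + 1 : ℕ) * K by push_cast; ring,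
      show n * V + n * (n - 1 : ℝ) * K ^ 2 + V + 2 * (n * K * K) =
        (n + 1 : ℕ) * V + (n + 1 : ℕ) * ((n + 1 : ℕ) - 1 : ℝ) * K ^ 2 by push_cast; ring] at hprod
    exact ⟨X × ℕ, fun z => u z.1 * p z.2, fun z => v z.1 * q z.2, fun z => S z.1 + z.2, hprod,
      hasSum_fiber_conv hu, hasSum_fiber_conv hv⟩

/-- V(p^{∗n}, p′^{∗n}) ≤ n·V(p,p′) + 4n·KL(p,p′) + n(n−1)·KL(p,p′)². -/
theorem stmt11 (p p' : ℕ → ℝ) (hp : IsPMF p) (hp' : IsPMF p') (h0 : p 0 = 0) (h0' : p' 0 = 0)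
    (habs : ∀ i, 0 < p i → 0 < p' i)
    (hKL : Summable fun i => p i * Real.log (p i / p' i))
    (hV : Summable fun i => p i * (Real.log (p i / p' i)) ^ 2) :
    ∀ n : ℕ, 1 ≤ n →
      Vd (convPow p n) (convPow p' n) ≤
        n * Vd p p' + 4 * n * KL p p' + n * (n - 1 : ℝ) * (KL p p') ^ 2 := by
  intro n _
  have hm : LogMoments p p' (KL p p') (Vd p p') :=
    ⟨hp.1, hp'.1, habs, hp.hasSum, hp'.hasSum, hKL.hasSum, hV.hasSum⟩
  obtain ⟨X, u, v, S, hX, hu, hv⟩ := exists_logMoments_convPow hm n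
  have := hX.Vd_map_le S hu hv
  have := hX.mean_nonneg
  linarith
end
end

section
/- Let (a_k)_{k∈ℕ} and (b_k)_{k∈ℕ} be summable sequences of strictly positive reals, with A = ∑_k a_k and B = ∑_k b_k, and suppose ∑_k a_k (log(a_k/b_k))² · 1{a_k ≥ b_k} < ∞. Then A · (log(A/B))² · 1{A ≥ B} ≤ ∑_k a_k (log(a_k/b_k))² · 1{a_k ≥ b_k}. (This follows by Jensen's inequality from the convexity of the function x ↦ x (log x)² · 1{x ≥ 1} on [0, ∞).) -/
open MeasureTheory
open scoped BigOperators Classical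

noncomputable section

/-- The tangent line at `t ≥ 1` of the convex function `x ↦ x (log x)² 1{x ≥ 1}` lies below its
graph; stated in perspective form, at `x = u / v` and multiplied by `v`. -/
lemma tangent_le_mul_log_sq {t u v : ℝ} (ht : 1 ≤ t) (hu : 0 < u) (hv : 0 < v) :
    ((Real.log t) ^ 2 + 2 * Real.log t) * u - 2 * Real.log t * t * v ≤
      if v ≤ u then u * (Real.log (u / v)) ^ 2 else 0 := by
  have ht0 : 0 < t := by linarith
  have hL : 0 ≤ Real.log t := Real.log_nonneg ht
  split_ifs with h
  · have h1 : Real.log t - Real.log (u / v) ≤ t * v / u - 1 := by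
      rw [← Real.log_div ht0.ne' (by positivity)]
      refine (Real.log_le_sub_one_of_pos (by positivity)).trans_eq ?_
      field_simp
    have h2 : u * (1 + Real.log t - Real.log (u / v)) ≤ t * v := by
      rw [← le_div_iff₀' hu]
      linarith
    nlinarith [mul_le_mul_of_nonneg_left h2 hL,
      mul_nonneg hu.le (sq_nonneg (Real.log t - Real.log (u / v)))]
  · have h1 : Real.log t + 1 ≤ t := by linarith [Real.log_le_sub_one_of_pos ht0]
    have h2 : (Real.log t + 2) * u ≤ 2 * t * v := by
      apply mul_le_mul (by linarith) (by linarith) hu.le (by linarith)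
    nlinarith [mul_le_mul_of_nonneg_left h2 hL]

/-- Jensen-type inequality for the convex function x ↦ x(log x)²·1{x ≥ 1}:
A(log(A/B))²·1{A ≥ B} ≤ ∑_k a_k(log(a_k/b_k))²·1{a_k ≥ b_k}. -/
theorem stmt12 (a b : ℕ → ℝ) (hapos : ∀ k, 0 < a k) (hbpos : ∀ k, 0 < b k)
    (hsa : Summable a) (hsb : Summable b)
    (hsum : Summable fun k => if b k ≤ a k then a k * (Real.log (a k / b k)) ^ 2 else 0) :
    (if (∑' k, b k) ≤ (∑' k, a k) then
        (∑' k, a k) * (Real.log ((∑' k, a k) / (∑' k, b k))) ^ 2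
      else 0) ≤
      ∑' k, if b k ≤ a k then a k * (Real.log (a k / b k)) ^ 2 else 0 := by
  have hB : 0 < ∑' k, b k := hsb.tsum_pos (fun k => (hbpos k).le) 0 (hbpos 0)
  split_ifs with hAB
  · set A := ∑' k, a k with hA
    set t := A / ∑' k, b k with ht
    have ht1 : 1 ≤ t := (one_le_div hB).2 hAB
    have hsum_tangent := (hsa.hasSum.mul_left ((Real.log t) ^ 2 + 2 * Real.log t)).sub
      (hsb.hasSum.mul_left (2 * Real.log t * t))
    have key := hasSum_le (fun k => tangent_le_mul_log_sq ht1 (hapos k) (hbpos k))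
      hsum_tangent hsum.hasSum
    refine le_trans (le_of_eq ?_) key
    have htB : t * ∑' k, b k = A := div_mul_cancel₀ _ hB.ne'
    rw [mul_assoc _ t, htB, ← hA]
    ring
  · refine tsum_nonneg fun k => ?_
    have := (hapos k).le
    split_ifs <;> positivity
end
end
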